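/- arXiv:1909.02187 — 4 statements merged into one kernel-verified Lean document; each statement's English description precedes it below -/
import Mathlib

section
/- Let K, T, S be positive integers with S ≤ T, let η ∈ (0, 1/2], and let Z be a K×K real symmetric matrix with ‖Z‖_* ≤ 1. Let W be an element of the clipped spectraplex Ω̃_K, and let W' be the minimizer over Ω̃_K of V ↦ tr(−V·log(I − ηZ)) + D_ψ(V‖W). Then tr((W − W')·(ηZ)) + tr(W'·(ηZ + log(I − ηZ) − log W' + log W)) ≤ 0. -/
open Finset Matrix

/-- The matrix logarithm of a symmetric matrix, defined via the spectral
decomposition (and junk value `0` on non-Hermitian matrices). -/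
noncomputable def matLog {K : ℕ} (A : Matrix (Fin K) (Fin K) ℝ) :
    Matrix (Fin K) (Fin K) ℝ :=
  if h : A.IsHermitian then
    (h.eigenvectorUnitary : Matrix (Fin K) (Fin K) ℝ) *
      Matrix.diagonal (fun i => Real.log (h.eigenvalues i)) *
      (star (h.eigenvectorUnitary : Matrix (Fin K) (Fin K) ℝ))
  else 0

/-- The spectraplex: symmetric PSD matrices of trace 1. -/
def spectraplex (K : ℕ) : Set (Matrix (Fin K) (Fin K) ℝ) :=
  {W | W.PosSemidef ∧ W.trace = 1}

/-- The clipped spectraplex `Ω̃_K = {W ∈ Ω_K : λ_min(W) ≥ S/(TK)}`,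
with the eigenvalue bound expressed in the Loewner order. -/
def clippedSpectraplex (K T S : ℕ) : Set (Matrix (Fin K) (Fin K) ℝ) :=
  {W | W.PosSemidef ∧ W.trace = 1 ∧
    (W - ((S : ℝ) / (T * K)) • (1 : Matrix (Fin K) (Fin K) ℝ)).PosSemidef}

/-- The negative von Neumann entropy `ψ(W) = tr(W log W)`. -/
noncomputable def vnEntropy {K : ℕ} (W : Matrix (Fin K) (Fin K) ℝ) : ℝ :=
  (W * matLog W).trace

/-- The Bregman divergence with respect to the negative von Neumann entropy. -/
noncomputable def bregPsi {K : ℕ} (A B : Matrix (Fin K) (Fin K) ℝ) : ℝ :=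
  vnEntropy A - vnEntropy B - ((A - B) * (1 + matLog B)).trace

/-- `‖Z‖_* ≤ 1` for a symmetric matrix `Z`: the spectral norm is at most one,
expressed as `-I ⪯ Z ⪯ I`. -/
def specNormLeOne {K : ℕ} (Z : Matrix (Fin K) (Fin K) ℝ) : Prop :=
  Z.IsHermitian ∧ ((1 : Matrix (Fin K) (Fin K) ℝ) - Z).PosSemidef ∧
    ((1 : Matrix (Fin K) (Fin K) ℝ) + Z).PosSemidef

theorem norm_normedSpaceExp_le {𝔸 : Type*} [NormedRing 𝔸] [NormOneClass 𝔸] [NormedAlgebra ℝ 𝔸]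
    [CompleteSpace 𝔸] (x : 𝔸) : ‖NormedSpace.exp x‖ ≤ Real.exp ‖x‖ := by
  rw [NormedSpace.exp_eq_tsum ℝ, Real.exp_eq_exp_ℝ]
  refine tsum_of_norm_bounded (NormedSpace.expSeries_div_hasSum_exp ‖x‖) fun n => ?_
  rw [norm_smul, norm_inv, Real.norm_natCast, div_eq_inv_mul]
  gcongr
  exact norm_pow_le x n

theorem norm_pow_sub_pow_le {𝔸 : Type*} [NormedRing 𝔸] [NormOneClass 𝔸] (a b : 𝔸) {M : ℝ}
    (hM : 1 ≤ M) (ha : ‖a‖ ≤ M) (hb : ‖b‖ ≤ M) (n : ℕ) :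
    ‖a ^ n - b ^ n‖ ≤ n * ‖a - b‖ * M ^ n := by
  induction n with
  | zero => simp
  | succ n ih =>
    have h : a ^ (n + 1) - b ^ (n + 1) = (a ^ n - b ^ n) * a + b ^ n * (a - b) := by
      rw [pow_succ, pow_succ]; noncomm_ring
    have hbn : ‖b ^ n‖ ≤ M ^ (n + 1) :=
      ((norm_pow_le b n).trans (pow_le_pow_left₀ (norm_nonneg _) hb n)).trans
        (pow_le_pow_right₀ hM n.le_succ)
    calc ‖a ^ (n + 1) - b ^ (n + 1)‖
        ≤ ‖a ^ n - b ^ n‖ * ‖a‖ + ‖b ^ n‖ * ‖a - b‖ := by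
          rw [h]
          exact (norm_add_le _ _).trans <| add_le_add (norm_mul_le _ _) (norm_mul_le _ _)
      _ ≤ (n * ‖a - b‖ * M ^ n) * M + M ^ (n + 1) * ‖a - b‖ := by gcongr
      _ = _ := by push_cast; ring

open Filter Topology in
/-- The **Lie–Trotter product formula** in a Banach algebra. -/
theorem tendsto_exp_mul_exp_pow {𝔸 : Type*} [NormedRing 𝔸] [NormOneClass 𝔸] [NormedAlgebra ℝ 𝔸]
    [CompleteSpace 𝔸] (x y : 𝔸) :
    Tendsto (fun n : ℕ => (NormedSpace.exp ((n : ℝ)⁻¹ • x) * NormedSpace.exp ((n : ℝ)⁻¹ • y)) ^ n)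
      atTop (𝓝 (NormedSpace.exp (x + y))) := by
  let : NormedAlgebra ℚ 𝔸 := NormedAlgebra.restrictScalars ℚ ℝ 𝔸
  set c := ‖x‖ + ‖y‖ with hc
  have hc0 : 0 ≤ c := by positivity
  have hderiv : HasDerivAt (fun t : ℝ => NormedSpace.exp (t • x) * NormedSpace.exp (t • y)
      - NormedSpace.exp (t • (x + y))) 0 0 := by
    have := ((hasDerivAt_exp_smul_const (𝕂 := ℝ) x 0).mul
      (hasDerivAt_exp_smul_const (𝕂 := ℝ) y 0)).sub (hasDerivAt_exp_smul_const (𝕂 := ℝ) (x + y) 0)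
    convert! this using 1
    simp
  have hlim : Tendsto (fun n : ℕ => (n : ℝ) * ‖NormedSpace.exp ((n : ℝ)⁻¹ • x) *
      NormedSpace.exp ((n : ℝ)⁻¹ • y) - NormedSpace.exp ((n : ℝ)⁻¹ • (x + y))‖) atTop (𝓝 0) := by
    have h0 : Tendsto (fun n : ℕ => (n : ℝ)⁻¹) atTop (𝓝[≠] 0) :=
      tendsto_nhdsWithin_iff.2 ⟨tendsto_inv_atTop_nhds_zero_nat, by
        filter_upwards [eventually_gt_atTop 0] with n hn
        simp [hn.ne']⟩
    have := ((hasDerivAt_iff_tendsto_slope_zero.1 hderiv).comp h0).norm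
    simpa [Function.comp_def, norm_smul] using this
  rw [tendsto_iff_norm_sub_tendsto_zero]
  refine squeeze_zero' (Eventually.of_forall fun _ => norm_nonneg _) ?_
    (by simpa only [zero_mul] using hlim.mul_const (Real.exp c))
  filter_upwards [eventually_gt_atTop 0] with n hn
  have hn' : (n : ℝ) ≠ 0 := by positivity
  have hpow : NormedSpace.exp (x + y) = NormedSpace.exp ((n : ℝ)⁻¹ • (x + y)) ^ n := by
    rw [← NormedSpace.exp_nsmul, ← Nat.cast_smul_eq_nsmul ℝ, smul_smul, mul_inv_cancel₀ hn',
      one_smul]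
  have hexp : Real.exp ((n : ℝ)⁻¹ * c) ^ n = Real.exp c := by
    rw [← Real.exp_nat_mul]; congr 1; field_simp
  rw [hpow, ← hexp]
  refine norm_pow_sub_pow_le (𝔸 := 𝔸) _ _ (M := Real.exp ((n : ℝ)⁻¹ * c)) (Real.one_le_exp (by positivity)) ?_ ?_ n
  · refine (norm_mul_le _ _).trans ((mul_le_mul (norm_normedSpaceExp_le _)
      (norm_normedSpaceExp_le _) (norm_nonneg _) (Real.exp_pos _).le).trans ?_)
    rw [← Real.exp_add, norm_smul, norm_smul, ← mul_add]
    simp [hc]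
  · refine (norm_normedSpaceExp_le _).trans (Real.exp_le_exp.2 ?_)
    rw [norm_smul, norm_inv, Real.norm_natCast]
    gcongr
    exact norm_add_le x y

section
variable {n : Type*} [Fintype n]

theorem two_mul_trace_transpose_mul_le (A B : Matrix n n ℝ) :
    2 * (Aᵀ * B).trace ≤ (Aᵀ * A).trace + (Bᵀ * B).trace := by
  have h : 0 ≤ ((A - B)ᵀ * (A - B)).trace := by
    simp only [Matrix.trace, Matrix.diag, Matrix.mul_apply, Matrix.transpose_apply]
    exact sum_nonneg fun i _ => sum_nonneg fun j _ => mul_self_nonneg _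
  have h2 : (Bᵀ * A).trace = (Aᵀ * B).trace := by
    rw [← Matrix.trace_transpose]; simp
  rw [Matrix.transpose_sub, sub_mul, mul_sub, mul_sub] at h
  simp only [Matrix.trace_sub] at h
  linarith

variable [DecidableEq n]

theorem Matrix.trace_mul_pow_comm {R : Type*} [CommSemiring R] (A B : Matrix n n R) (k : ℕ) :
    ((A * B) ^ k).trace = ((B * A) ^ k).trace := by
  cases k with
  | zero => simp
  | succ k =>
    have h : (A * B) ^ (k + 1) = A * ((B * A) ^ k * B) := by
      rw [pow_succ', mul_assoc]
      congr 1
      have : SemiconjBy B (A * B) (B * A) := by simp [SemiconjBy, mul_assoc]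
      exact (this.pow_right k).eq
    rw [h, Matrix.trace_mul_comm, mul_assoc, ← pow_succ]

theorem trace_pow_two_pow_le (k : ℕ) :
    (∀ M : Matrix n n ℝ, (M ^ 2 ^ (k + 1)).trace ≤ ((Mᵀ * M) ^ 2 ^ k).trace) ∧
      ∀ P Q : Matrix n n ℝ, P.IsSymm → Q.IsSymm →
        ((P * Q) ^ 2 ^ k).trace ≤ (P ^ 2 ^ k * Q ^ 2 ^ k).trace := by
  induction k with
  | zero =>
    refine ⟨fun M => ?_, fun P Q _ _ => by simp⟩
    have h := two_mul_trace_transpose_mul_le Mᵀ M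
    rw [transpose_transpose, Matrix.trace_mul_comm M Mᵀ] at h
    simp only [zero_add, pow_one, pow_zero, pow_two]
    linarith
  | succ k ih =>
    obtain ⟨ih1, ih2⟩ := ih
    refine ⟨fun M => ?_, fun P Q hP hQ => ?_⟩
    · have hS1 : (Mᵀ * M).IsSymm := by simp [Matrix.IsSymm]
      have hS2 : (M * Mᵀ).IsSymm := by simp [Matrix.IsSymm]
      have e1 : ((M * M)ᵀ * (M * M)) = Mᵀ * ((Mᵀ * M) * M) := by
        simp [mul_assoc]
      have h1 := ih1 (M * M)
      have h2 := ih2 _ _ hS1 hS2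
      rw [e1, Matrix.trace_mul_pow_comm Mᵀ, mul_assoc _ M] at h1
      have h3 := two_mul_trace_transpose_mul_le ((Mᵀ * M) ^ 2 ^ k) ((M * Mᵀ) ^ 2 ^ k)
      rw [Matrix.transpose_pow, Matrix.transpose_pow, hS1.eq, hS2.eq, ← pow_add, ← pow_add,
        Matrix.trace_mul_pow_comm M Mᵀ, ← two_mul, ← mul_two, ← pow_succ] at h3
      have e2 : M ^ 2 ^ (k + 1 + 1) = (M * M) ^ 2 ^ (k + 1) := by
        rw [← pow_two, ← pow_mul, ← pow_succ']
      rw [e2]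
      linarith
    · have h1 := ih1 (P * Q)
      have h2 := ih2 (P * P) (Q * Q) (by simp [Matrix.IsSymm, hP.eq])
        (by simp [Matrix.IsSymm, hQ.eq])
      rw [Matrix.transpose_mul, hP.eq, hQ.eq, mul_assoc, Matrix.trace_mul_pow_comm Q] at h1
      have e : P * (P * Q) * Q = P * P * (Q * Q) := by simp only [mul_assoc]
      rw [e] at h1
      rw [← pow_two, ← pow_two, ← pow_mul, ← pow_mul, ← pow_succ'] at h2
      rw [pow_two, pow_two] at h2
      exact h1.trans h2

open scoped Matrix.Norms.Operator in
open Filter Topology in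
/-- The **Golden–Thompson inequality** for real symmetric matrices. -/
theorem trace_exp_add_le [Nonempty n] {X Y : Matrix n n ℝ} (hX : X.IsSymm) (hY : Y.IsSymm) :
    (NormedSpace.exp (X + Y)).trace ≤ (NormedSpace.exp X * NormedSpace.exp Y).trace := by
  have hpow (A : Matrix n n ℝ) (m : ℕ) (hm : 0 < m) :
      NormedSpace.exp ((m : ℝ)⁻¹ • A) ^ m = NormedSpace.exp A := by
    rw [← Matrix.exp_nsmul, ← Nat.cast_smul_eq_nsmul ℝ, smul_smul,
      mul_inv_cancel₀ (by positivity), one_smul]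
  have h1 := ((tendsto_exp_mul_exp_pow X Y).comp
    (tendsto_pow_atTop_atTop_of_one_lt (one_lt_two (α := ℕ))))
  have h2 := ((continuous_id.matrix_trace (n := n) (R := ℝ)).tendsto _).comp h1
  refine le_of_tendsto h2 (Eventually.of_forall fun k => ?_)
  have h3 := (trace_pow_two_pow_le k).2 _ _ (hX.smul ((2 ^ k : ℕ) : ℝ)⁻¹).exp
    (hY.smul ((2 ^ k : ℕ) : ℝ)⁻¹).exp
  rwa [hpow _ _ (by positivity), hpow _ _ (by positivity)] at h3

end

theorem trace_conj_diagonal_mul_conj_diagonal {n : Type*} [Fintype n] [DecidableEq n]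
    (U R : Matrix n n ℝ) (a b : n → ℝ) :
    ((U * diagonal a * star U) * (R * diagonal b * star R)).trace
      = ∑ i, ∑ j, a i * b j * ((star U * R) i j) ^ 2 := by
  have h : ((U * diagonal a * star U) * (R * diagonal b * star R)).trace
      = ((diagonal a * (star U * R)) * (diagonal b * star (star U * R))).trace := by
    rw [star_mul, star_star, mul_assoc U, mul_assoc U, Matrix.trace_mul_comm]
    simp only [mul_assoc]
  rw [h]
  generalize star U * R = C
  refine sum_congr rfl fun i _ => ?_
  rw [Matrix.diag_apply, Matrix.mul_apply]
  refine sum_congr rfl fun j _ => ?_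
  simp [Matrix.star_eq_conjTranspose]
  ring

theorem Matrix.IsHermitian.eq_conj_diagonal {n : Type*} [Fintype n] [DecidableEq n]
    {A : Matrix n n ℝ} (hA : A.IsHermitian) :
    A = (hA.eigenvectorUnitary : Matrix n n ℝ) * diagonal hA.eigenvalues *
      star (hA.eigenvectorUnitary : Matrix n n ℝ) := by
  have h := hA.spectral_theorem
  rw [Unitary.conjStarAlgAut_apply] at h
  exact h

theorem exp_conj_diagonal {n : Type*} [Fintype n] [DecidableEq n]
    (U : unitary (Matrix n n ℝ)) (a : n → ℝ) :
    NormedSpace.exp ((U : Matrix n n ℝ) * diagonal a * star (U : Matrix n n ℝ))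
      = U * diagonal (fun i => Real.exp (a i)) * star (U : Matrix n n ℝ) := by
  have h := Matrix.exp_units_conj (Unitary.toUnits U) (diagonal a)
  rw [Matrix.exp_diagonal, Pi.exp_def] at h
  simpa [← Real.exp_eq_exp_ℝ] using h

theorem isSymm_matLog {K : ℕ} (A : Matrix (Fin K) (Fin K) ℝ) : (matLog A).IsSymm := by
  unfold matLog
  split_ifs with h
  · simp [Matrix.IsSymm, Matrix.star_eq_conjTranspose, mul_assoc]
  · simp [Matrix.IsSymm]

theorem exp_matLog {K : ℕ} {A : Matrix (Fin K) (Fin K) ℝ} (hA : A.PosDef) :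
    NormedSpace.exp (matLog A) = A := by
  rw [matLog, dif_pos hA.1, exp_conj_diagonal]
  conv_rhs => rw [hA.1.eq_conj_diagonal]
  congr 3
  ext i
  exact Real.exp_log (hA.eigenvalues_pos i)

/-- **Klein's inequality** in its variational form. -/
theorem trace_mul_sub_matLog_le {K : ℕ} {V H : Matrix (Fin K) (Fin K) ℝ} (hV : V.PosDef)
    (hH : H.IsHermitian) :
    (V * H).trace - (V * matLog V).trace ≤ (NormedSpace.exp H).trace - V.trace := by
  set U : Matrix (Fin K) (Fin K) ℝ := (hV.1.eigenvectorUnitary : Matrix (Fin K) (Fin K) ℝ)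
  set R : Matrix (Fin K) (Fin K) ℝ := (hH.eigenvectorUnitary : Matrix (Fin K) (Fin K) ℝ)
  set v := hV.1.eigenvalues
  set h := hH.eigenvalues
  have hUU : star U * U = 1 := Unitary.coe_star_mul_self hV.1.eigenvectorUnitary
  have hUU' : U * star U = 1 := Unitary.coe_mul_star_self hV.1.eigenvectorUnitary
  have hRR' : R * star R = 1 := Unitary.coe_mul_star_self hH.eigenvectorUnitary
  have eV : V = U * diagonal v * star U := hV.1.eq_conj_diagonal
  have eH : H = R * diagonal h * star R := hH.eq_conj_diagonal
  have eE : NormedSpace.exp H = R * diagonal (fun j => Real.exp (h j)) * star R := by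
    conv_lhs => rw [eH]
    exact exp_conj_diagonal _ _
  have eL : matLog V = U * diagonal (fun i => Real.log (v i)) * star U := dif_pos hV.1
  have eVL : V * matLog V = U * diagonal (fun i => v i * Real.log (v i)) * star U := by
    rw [eL, ← diagonal_mul_diagonal]
    conv_lhs => rw [eV]
    calc _ = U * diagonal v * (star U * U) * diagonal (fun i => Real.log (v i)) * star U := by
          simp only [mul_assoc]
      _ = _ := by rw [hUU, mul_one, mul_assoc U]
  have left (a : Fin K → ℝ) : (U * diagonal a * star U).trace
      = ∑ i, ∑ j, a i * 1 * ((star U * R) i j) ^ 2 := by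
    have := trace_conj_diagonal_mul_conj_diagonal U R a (fun _ => 1)
    rw [← this, diagonal_one, mul_one, hRR', mul_one]
  have right (b : Fin K → ℝ) : (R * diagonal b * star R).trace
      = ∑ i, ∑ j, 1 * b j * ((star U * R) i j) ^ 2 := by
    have := trace_conj_diagonal_mul_conj_diagonal U R (fun _ => 1) b
    rw [← this, diagonal_one, mul_one, hUU', one_mul]
  have e1 : (V * H).trace = ∑ i, ∑ j, v i * h j * ((star U * R) i j) ^ 2 := by
    rw [← trace_conj_diagonal_mul_conj_diagonal, ← eV, ← eH]
  have e4 : V.trace = ∑ i, ∑ j, v i * 1 * ((star U * R) i j) ^ 2 := by rw [← left, ← eV]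
  rw [e1, eVL, eE, left, right, e4]
  simp only [← sum_sub_distrib]
  refine sum_le_sum fun i _ => sum_le_sum fun j _ => ?_
  have hvi : 0 < v i := hV.eigenvalues_pos i
  have key : v i * h j - v i * Real.log (v i) ≤ Real.exp (h j) - v i := by
    have h1 := Real.add_one_le_exp (h j - Real.log (v i))
    rw [Real.exp_sub, Real.exp_log hvi, le_div_iff₀ hvi] at h1
    linarith
  have := mul_le_mul_of_nonneg_right key (sq_nonneg ((star U * R) i j))
  linarith

theorem posDef_of_mem_clippedSpectraplex {K T S : ℕ} (hK : 0 < K) (hT : 0 < T) (hS : 0 < S)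
    {W : Matrix (Fin K) (Fin K) ℝ} (hW : W ∈ clippedSpectraplex K T S) : W.PosDef := by
  have hpos : (0 : ℝ) < (S : ℝ) / (T * K) := by positivity
  have := (PosDef.one (n := Fin K) (R := ℝ)).smul hpos
  simpa using this.posSemidef_add hW.2.2

theorem posDef_one_sub_smul {K : ℕ} {η : ℝ} (hη : 0 < η) (hη2 : η ≤ 1 / 2)
    {Z : Matrix (Fin K) (Fin K) ℝ} (hZ : specNormLeOne Z) : (1 - η • Z).PosDef := by
  have h1 := (PosDef.one (n := Fin K) (R := ℝ)).smul (by linarith : (0 : ℝ) < 1 - η)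
  have h2 := h1.add_posSemidef (hZ.2.1.smul hη.le)
  convert h2 using 1
  module

theorem pcsp_step_first_term_nonpos
    (K T S : ℕ) (hK : 0 < K) (hT : 0 < T) (hS : 0 < S) (hST : S ≤ T)
    (η : ℝ) (hη : 0 < η) (hη2 : η ≤ 1 / 2)
    (Z : Matrix (Fin K) (Fin K) ℝ) (hZ : specNormLeOne Z)
    (W : Matrix (Fin K) (Fin K) ℝ) (hW : W ∈ clippedSpectraplex K T S)
    (W' : Matrix (Fin K) (Fin K) ℝ)
    (hW' : W' ∈ clippedSpectraplex K T S ∧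
      ∀ V ∈ clippedSpectraplex K T S,
        (-(W' * matLog (1 - η • Z))).trace + bregPsi W' W
          ≤ (-(V * matLog (1 - η • Z))).trace + bregPsi V W) :
    ((W - W') * (η • Z)).trace
      + (W' * (η • Z + matLog (1 - η • Z) - matLog W' + matLog W)).trace ≤ 0 := by
  have : Nonempty (Fin K) := ⟨⟨0, hK⟩⟩
  have hA := posDef_one_sub_smul hη hη2 hZ
  have hWd := posDef_of_mem_clippedSpectraplex hK hT hS hW
  have hVd := posDef_of_mem_clippedSpectraplex hK hT hS hW'.1
  have hLs := isSymm_matLog (1 - η • Z)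
  have hWs := isSymm_matLog W
  have klein := trace_mul_sub_matLog_le hVd (H := matLog (1 - η • Z) + matLog W)
    (by simpa [Matrix.IsHermitian, Matrix.IsSymm] using hLs.add hWs)
  have gt := trace_exp_add_le hLs hWs
  rw [exp_matLog hA, exp_matLog hWd, sub_mul, one_mul, Matrix.trace_sub,
    Matrix.trace_mul_comm (η • Z) W, hW.2.1] at gt
  rw [hW'.1.2.1, mul_add, Matrix.trace_add] at klein
  simp only [sub_mul, mul_add, mul_sub, Matrix.trace_add, Matrix.trace_sub]
  linarith
end

section
/- Let K, T, S be positive integers with S ≤ T, let η ∈ (0, 1/2], let U be a K×K real symmetric positive semidefinite matrix with trace 1, and let Z be a K×K real symmetric matrix with ‖Z‖_* ≤ 1. Define Ū = (1 − S/T)·U + (S/(TK))·I. Then tr(−Ū·(ηZ + log(I − ηZ))) ≤ η²·tr(U·Z²) + ηS/(2T). -/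
open Finset Matrix

namespace Matrix

variable {n : Type*} [Fintype n] [DecidableEq n]

lemma PosSemidef.trace_mul_conj_diagonal_nonneg {A : Matrix n n ℝ} (hA : A.PosSemidef)
    (V : Matrix n n ℝ) {d : n → ℝ} (hd : ∀ i, 0 ≤ d i) :
    0 ≤ (A * (V * diagonal d * star V)).trace := by
  have h : (A * (V * diagonal d * star V)).trace = (star V * A * V * diagonal d).trace := by
    rw [← mul_assoc, trace_mul_comm]
    simp only [mul_assoc]
  rw [h, trace]
  refine Finset.sum_nonneg fun i _ => ?_
  rw [diag_apply, mul_diagonal]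
  exact mul_nonneg ((hA.conjTranspose_mul_mul_same V).diag_nonneg) (hd i)

lemma IsHermitian.eq_conj_diagonal_eigenvalues {A : Matrix n n ℝ} (hA : A.IsHermitian) :
    A = (hA.eigenvectorUnitary : Matrix n n ℝ) * diagonal hA.eigenvalues *
      star (hA.eigenvectorUnitary : Matrix n n ℝ) := by
  conv_lhs => rw [hA.spectral_theorem, Unitary.conjStarAlgAut_apply]
  rfl

lemma PosSemidef.trace_mul_nonneg {A B : Matrix n n ℝ} (hA : A.PosSemidef)
    (hB : B.PosSemidef) : 0 ≤ (A * B).trace := by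
  rw [hB.1.eq_conj_diagonal_eigenvalues]
  exact hA.trace_mul_conj_diagonal_nonneg _ hB.eigenvalues_nonneg

lemma IsHermitian.le_eigenvalues {A : Matrix n n ℝ} (hA : A.IsHermitian) {c : ℝ}
    (h : (A - c • (1 : Matrix n n ℝ)).PosSemidef) (i : n) : c ≤ hA.eigenvalues i := by
  have hV := Unitary.coe_star_mul_self hA.eigenvectorUnitary
  have hd : star (hA.eigenvectorUnitary : Matrix n n ℝ) * (A - c • (1 : Matrix n n ℝ)) *
      (hA.eigenvectorUnitary : Matrix n n ℝ) = diagonal fun i => hA.eigenvalues i - c := by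
    have hA' : star (hA.eigenvectorUnitary : Matrix n n ℝ) * A *
        (hA.eigenvectorUnitary : Matrix n n ℝ) = diagonal hA.eigenvalues := by
      conv_lhs => enter [1, 2]; rw [hA.eq_conj_diagonal_eigenvalues]
      simp only [← mul_assoc, hV, one_mul]
      rw [mul_assoc, hV, mul_one]
    rw [mul_sub, sub_mul, hA', mul_smul_comm, mul_one, smul_mul_assoc, hV, smul_one_eq_diagonal,
      diagonal_sub]
  have hp := h.conjTranspose_mul_mul_same (hA.eigenvectorUnitary : Matrix n n ℝ)
  rw [← star_eq_conjTranspose, hd, posSemidef_diagonal_iff] at hp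
  exact sub_nonneg.mp (hp i)

end Matrix

lemma Real.one_sub_sub_sq_le_log {t : ℝ} (ht : 1 / 2 ≤ t) :
    -(1 - t) - (1 - t) ^ 2 ≤ Real.log t := by
  rcases le_total 1 t with h | h
  · have h1 := Real.le_log_one_add_of_nonneg (sub_nonneg.mpr h)
    rw [add_sub_cancel] at h1
    refine le_trans ?_ h1
    rw [le_div_iff₀ (by linarith)]
    nlinarith [pow_nonneg (sub_nonneg.mpr h) 2, pow_nonneg (sub_nonneg.mpr h) 3]
  · obtain ⟨x, rfl⟩ : ∃ x, t = 1 - x := ⟨1 - t, by ring⟩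
    have hx0 : 0 ≤ x := by linarith
    have hx : x ≤ 1 / 2 := by linarith
    have h1 := Real.abs_log_sub_add_sum_range_le (x := x)
      (by rw [abs_of_nonneg hx0]; linarith) 4
    rw [abs_of_nonneg hx0] at h1
    have h2 := (abs_le.mp h1).1
    norm_num [Finset.sum_range_succ] at h2
    have h3 : x ^ 5 / (1 - x) ≤ x ^ 2 / 4 := by
      rw [div_le_iff₀ (by linarith)]
      have : x ^ 3 ≤ (1 / 2) ^ 3 := pow_le_pow_left₀ hx0 hx 3
      nlinarith [mul_le_mul_of_nonneg_left this (sq_nonneg x),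
        mul_le_mul_of_nonneg_left hx (sq_nonneg x)]
    have h4 : x ^ 3 ≤ x ^ 2 / 2 := by nlinarith [mul_le_mul_of_nonneg_left hx (sq_nonneg x)]
    have h5 : x ^ 4 ≤ x ^ 2 / 4 := by
      nlinarith [mul_le_mul_of_nonneg_left hx (pow_nonneg hx0 3)]
    rw [sub_sub_cancel]
    nlinarith [sq_nonneg x]

/-- The inequality `-(1 - A) - log A ⪯ (1 - A)²` for `A ⪰ 1/2`, tested against `W ⪰ 0`. -/
lemma trace_mul_matLog_add_sq_nonneg {K : ℕ} {W A : Matrix (Fin K) (Fin K) ℝ}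
    (hW : W.PosSemidef) (hA : A.IsHermitian)
    (h : (A - (1 / 2 : ℝ) • (1 : Matrix (Fin K) (Fin K) ℝ)).PosSemidef) :
    0 ≤ (W * ((1 - A) + matLog A + (1 - A) * (1 - A))).trace := by
  set V := (hA.eigenvectorUnitary : Matrix (Fin K) (Fin K) ℝ)
  have hV : star V * V = 1 := Unitary.coe_star_mul_self hA.eigenvectorUnitary
  have hV' : V * star V = 1 := Unitary.coe_mul_star_self hA.eigenvectorUnitary
  have h1 : 1 - A = V * diagonal (fun i => 1 - hA.eigenvalues i) * star V := by
    have hd : diagonal (fun i => 1 - hA.eigenvalues i) = 1 - diagonal hA.eigenvalues := by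
      rw [← diagonal_one, diagonal_sub]
    rw [hd, mul_sub, sub_mul, mul_one, hV', ← hA.eq_conj_diagonal_eigenvalues]
  have h2 : (1 - A) * (1 - A) = V * diagonal (fun i => (1 - hA.eigenvalues i) ^ 2) * star V := by
    rw [h1]
    calc _ = V * diagonal (fun i => 1 - hA.eigenvalues i) * (star V * V) *
          diagonal (fun i => 1 - hA.eigenvalues i) * star V := by simp only [mul_assoc]
      _ = _ := by rw [hV, mul_one, mul_assoc V, diagonal_mul_diagonal]; simp only [sq]
  have h3 : matLog A = V * diagonal (fun i => Real.log (hA.eigenvalues i)) * star V := by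
    rw [matLog, dif_pos hA]
  rw [h2, h3, h1, ← add_mul, ← mul_add, ← add_mul, ← mul_add, diagonal_add, diagonal_add]
  refine hW.trace_mul_conj_diagonal_nonneg V fun i => ?_
  linarith [Real.one_sub_sub_sq_le_log (hA.le_eigenvalues h i)]

lemma specNormLeOne.trace_mul_self_le {K : ℕ} {Z : Matrix (Fin K) (Fin K) ℝ}
    (hZ : specNormLeOne Z) : (Z * Z).trace ≤ K := by
  have h := hZ.2.1.trace_mul_nonneg hZ.2.2
  have e : (1 - Z) * (1 + Z) = 1 - Z * Z := by noncomm_ring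
  rw [e, trace_sub, trace_one, Fintype.card_fin] at h
  linarith

theorem pcsp_step_second_term_bound
    (K T S : ℕ) (hK : 0 < K) (hT : 0 < T) (hS : 0 < S) (hST : S ≤ T)
    (η : ℝ) (hη : 0 < η) (hη2 : η ≤ 1 / 2)
    (U : Matrix (Fin K) (Fin K) ℝ) (hU : U.PosSemidef) (hUtr : U.trace = 1)
    (Z : Matrix (Fin K) (Fin K) ℝ) (hZ : specNormLeOne Z)
    (Ubar : Matrix (Fin K) (Fin K) ℝ)
    (hUbar : Ubar = (1 - (S : ℝ) / T) • U
      + ((S : ℝ) / (T * K)) • (1 : Matrix (Fin K) (Fin K) ℝ)) :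
    (-(Ubar * (η • Z + matLog (1 - η • Z)))).trace
      ≤ η ^ 2 * (U * Z * Z).trace + η * S / (2 * T) := by
  have hTpos : (0 : ℝ) < T := by exact_mod_cast hT
  have hKpos : (0 : ℝ) < K := by exact_mod_cast hK
  have hr0 : (0 : ℝ) ≤ S / T := by positivity
  have hr1 : (S : ℝ) / T ≤ 1 := (div_le_one hTpos).mpr (by exact_mod_cast hST)
  have hW : Ubar.PosSemidef := by
    rw [hUbar]
    exact (hU.smul (sub_nonneg.mpr hr1)).add (PosSemidef.one.smul (by positivity))
  have hA : (1 - η • Z).IsHermitian := isHermitian_one.sub (by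
    rw [IsHermitian, conjTranspose_smul, hZ.1.eq, star_trivial])
  have hA2 : (1 - η • Z - (1 / 2 : ℝ) • (1 : Matrix (Fin K) (Fin K) ℝ)).PosSemidef := by
    have e : 1 - η • Z - (1 / 2 : ℝ) • (1 : Matrix (Fin K) (Fin K) ℝ)
        = η • (1 - Z) + (1 / 2 - η) • (1 : Matrix (Fin K) (Fin K) ℝ) := by module
    rw [e]
    exact (hZ.2.1.smul hη.le).add (PosSemidef.one.smul (sub_nonneg.mpr hη2))
  have hmain := trace_mul_matLog_add_sq_nonneg hW hA hA2
  rw [sub_sub_cancel, mul_add, trace_add] at hmain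
  have hsq : (Ubar * ((η • Z) * (η • Z))).trace = η ^ 2 * ((1 - (S : ℝ) / T) * (U * Z * Z).trace
      + (S : ℝ) / (T * K) * (Z * Z).trace) := by
    rw [hUbar]
    simp only [smul_mul_assoc, mul_smul_comm, add_mul, one_mul, trace_add, trace_smul,
      smul_eq_mul, smul_add, mul_assoc]
    ring
  have hUZ : 0 ≤ (U * Z * Z).trace := by
    have h := (hU.mul_mul_conjTranspose_same Z).trace_nonneg
    rwa [hZ.1.eq, trace_mul_comm, ← mul_assoc, trace_mul_comm, ← mul_assoc] at h
  have hZZ : (S : ℝ) / (T * K) * (Z * Z).trace ≤ S / T := by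
    calc (S : ℝ) / (T * K) * (Z * Z).trace ≤ S / (T * K) * K :=
          mul_le_mul_of_nonneg_left hZ.trace_mul_self_le (by positivity)
      _ = S / T := by field_simp
  have hfirst : (1 - (S : ℝ) / T) * (U * Z * Z).trace ≤ (U * Z * Z).trace :=
    mul_le_of_le_one_left hUZ (by linarith)
  have hη' : η ^ 2 * ((S : ℝ) / T) ≤ η * S / (2 * T) := by
    calc η ^ 2 * ((S : ℝ) / T) ≤ (η * (1 / 2)) * (S / T) :=
          mul_le_mul_of_nonneg_right (by nlinarith) hr0
      _ = _ := by field_simp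
  have hbound := mul_le_mul_of_nonneg_left (add_le_add hfirst hZZ) (sq_nonneg η)
  rw [trace_neg]
  linarith
end

section
/- Let K, T, S be positive integers with S ≤ T, and let X, Y, Z be elements of the clipped spectraplex Ω̃_K. Then tr(X·(log Y − log Z)) ≤ log(KT/S). -/
open Finset Matrix

/-- The quadratic forms `(Uᴴ X U)ᵢᵢ` of `X` in the eigenbasis of `A` diagonalise
`X ↦ tr (X log A)`. -/
theorem trace_mul_matLog {K : ℕ} {A : Matrix (Fin K) (Fin K) ℝ} (hA : A.IsHermitian)
    (X : Matrix (Fin K) (Fin K) ℝ) :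
    (X * matLog A).trace = ∑ i, ((hA.eigenvectorUnitary : Matrix (Fin K) (Fin K) ℝ)ᴴ * X *
      (hA.eigenvectorUnitary : Matrix (Fin K) (Fin K) ℝ)) i i * Real.log (hA.eigenvalues i) := by
  rw [matLog, dif_pos hA, star_eq_conjTranspose, ← Matrix.mul_assoc, Matrix.trace_mul_comm]
  simp only [← Matrix.mul_assoc]
  simp [Matrix.trace, Matrix.mul_diagonal]

theorem sum_diag_eigenvectorUnitary_conj {K : ℕ} {A : Matrix (Fin K) (Fin K) ℝ}
    (hA : A.IsHermitian) (X : Matrix (Fin K) (Fin K) ℝ) :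
    ∑ i, ((hA.eigenvectorUnitary : Matrix (Fin K) (Fin K) ℝ)ᴴ * X *
      (hA.eigenvectorUnitary : Matrix (Fin K) (Fin K) ℝ)) i i = X.trace := by
  have h : (hA.eigenvectorUnitary : Matrix (Fin K) (Fin K) ℝ) *
      (hA.eigenvectorUnitary : Matrix (Fin K) (Fin K) ℝ)ᴴ = 1 :=
    Unitary.coe_mul_star_self hA.eigenvectorUnitary
  change Matrix.trace _ = _
  rw [Matrix.trace_mul_comm, ← Matrix.mul_assoc, h, Matrix.one_mul]

theorem le_eigenvalues_of_posSemidef_sub {K : ℕ} {A : Matrix (Fin K) (Fin K) ℝ}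
    (hA : A.IsHermitian) {c : ℝ}
    (h : (A - c • (1 : Matrix (Fin K) (Fin K) ℝ)).PosSemidef) (i : Fin K) :
    c ≤ hA.eigenvalues i := by
  have hv := h.dotProduct_mulVec_nonneg (hA.eigenvectorBasis i).ofLp
  have hn : star (hA.eigenvectorBasis i).ofLp ⬝ᵥ (hA.eigenvectorBasis i).ofLp = 1 := by
    rw [dotProduct_comm, ← EuclideanSpace.inner_eq_star_dotProduct,
      real_inner_self_eq_norm_sq, hA.eigenvectorBasis.orthonormal.1 i, one_pow]
  rw [Matrix.sub_mulVec, Matrix.smul_mulVec, Matrix.one_mulVec, hA.mulVec_eigenvectorBasis,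
    dotProduct_sub, dotProduct_smul, dotProduct_smul, hn] at hv
  simpa using hv

theorem eigenvalues_le_trace {K : ℕ} {A : Matrix (Fin K) (Fin K) ℝ} (hA : A.PosSemidef)
    (i : Fin K) : hA.isHermitian.eigenvalues i ≤ A.trace := by
  rw [hA.isHermitian.trace_eq_sum_eigenvalues]
  exact Finset.single_le_sum (f := hA.isHermitian.eigenvalues)
    (fun j _ => hA.eigenvalues_nonneg j) (Finset.mem_univ i)

theorem clipped_spectraplex_log_trace_bound
    (K T S : ℕ) (hK : 0 < K) (hT : 0 < T) (hS : 0 < S) (hST : S ≤ T)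
    (X Y Z : Matrix (Fin K) (Fin K) ℝ)
    (hX : X ∈ clippedSpectraplex K T S)
    (hY : Y ∈ clippedSpectraplex K T S)
    (hZ : Z ∈ clippedSpectraplex K T S) :
    (X * (matLog Y - matLog Z)).trace ≤ Real.log (K * T / S) := by
  obtain ⟨hXp, hXt, -⟩ := hX
  obtain ⟨hYp, hYt, -⟩ := hY
  obtain ⟨hZp, hZt, hZc⟩ := hZ
  have hc : (0 : ℝ) < S / (T * K) := by positivity
  have hupper : (X * matLog Y).trace ≤ 0 := by
    rw [trace_mul_matLog hYp.isHermitian]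
    refine Finset.sum_nonpos fun i _ => mul_nonpos_of_nonneg_of_nonpos
      (hXp.conjTranspose_mul_mul_same _).diag_nonneg
      (Real.log_nonpos (hYp.eigenvalues_nonneg i) ?_)
    exact hYt ▸ eigenvalues_le_trace hYp i
  have hlower : Real.log (S / (T * K)) ≤ (X * matLog Z).trace := by
    rw [trace_mul_matLog hZp.isHermitian, ← one_mul (Real.log (S / (T * K))), ← hXt,
      ← sum_diag_eigenvectorUnitary_conj hZp.isHermitian X, Finset.sum_mul]
    exact Finset.sum_le_sum fun i _ => mul_le_mul_of_nonneg_left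
      (Real.log_le_log hc (le_eigenvalues_of_posSemidef_sub hZp.isHermitian hZc i))
      (hXp.conjTranspose_mul_mul_same _).diag_nonneg
  have hlog : Real.log (K * T / S) = -Real.log (S / (T * K)) := by
    rw [← Real.log_inv, inv_div, mul_comm]
  rw [Matrix.mul_sub, Matrix.trace_sub, hlog]
  linarith
end

section
/- Let K, T, S be positive integers with S ≤ T, let η ∈ (0, 1/2], let ℓ ∈ [0,1]^K, and let j ∈ [K]. Let e ∈ ℝ^K be the one-hot vector with e[j] = 1 and e[i] = 0 for i ≠ j, and define ē[i] = (1 − S/T)·e[i] + S/(TK) for each i. Then ∑_{i=1}^K ē[i]·(−ηℓ[i] − log(1 − ηℓ[i])) ≤ η²·(ℓ[j])² + ηS/(2T). -/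
open Finset

theorem neg_sub_log_one_sub_le_sq {x : ℝ} (h0 : 0 ≤ x) (h1 : x ≤ 1 / 2) :
    -x - Real.log (1 - x) ≤ x ^ 2 := by
  have h := Real.abs_log_sub_add_sum_range_le
    (show |x| < 1 by rw [abs_of_nonneg h0]; linarith) 4
  rw [abs_of_nonneg h0] at h
  have h2 := (abs_le.mp h).1
  have h3 : x ^ 5 / (1 - x) ≤ 2 * x ^ 5 := by
    rw [div_le_iff₀ (by linarith)]
    nlinarith [pow_nonneg h0 5]
  have h4 : x ^ 3 ≤ x ^ 2 / 2 := by nlinarith [pow_nonneg h0 2]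
  have h5 : x ^ 4 ≤ x ^ 3 / 2 := by nlinarith [pow_nonneg h0 3]
  have h6 : x ^ 5 ≤ x ^ 4 / 2 := by nlinarith [pow_nonneg h0 4]
  norm_num [Finset.sum_range_succ] at h2
  nlinarith [sq_nonneg x]

theorem prod_step_B_term_bound
    (K T S : ℕ) (hK : 0 < K) (hT : 0 < T) (hS : 0 < S) (hST : S ≤ T)
    (η : ℝ) (hη : 0 < η) (hη2 : η ≤ 1 / 2)
    (ℓ : Fin K → ℝ) (hℓ : ∀ i, ℓ i ∈ Set.Icc (0 : ℝ) 1)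
    (j : Fin K)
    (e : Fin K → ℝ) (he : ∀ i, e i = if i = j then 1 else 0)
    (ebar : Fin K → ℝ)
    (hebar : ∀ i, ebar i = (1 - (S : ℝ) / T) * e i + (S : ℝ) / (T * K)) :
    ∑ i, ebar i * (-(η * ℓ i) - Real.log (1 - η * ℓ i))
      ≤ η ^ 2 * (ℓ j) ^ 2 + η * S / (2 * T) := by
  have hK' : (0 : ℝ) < K := by exact_mod_cast hK
  have hT' : (0 : ℝ) < T := by exact_mod_cast hT
  have hp0 : 0 ≤ (S : ℝ) / T := by positivity
  have hp1 : (S : ℝ) / T ≤ 1 := by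
    rw [div_le_one hT']
    exact_mod_cast hST
  have hsq (i : Fin K) :
      -(η * ℓ i) - Real.log (1 - η * ℓ i) ≤ η ^ 2 * ℓ i ^ 2 := by
    rw [← mul_pow]
    exact neg_sub_log_one_sub_le_sq (mul_nonneg hη.le (hℓ i).1)
      ((mul_le_of_le_one_right hη.le (hℓ i).2).trans hη2)
  have hhalf (i : Fin K) : -(η * ℓ i) - Real.log (1 - η * ℓ i) ≤ η / 2 := by
    have hℓsq : ℓ i ^ 2 ≤ 1 := pow_le_one₀ (hℓ i).1 (hℓ i).2
    nlinarith [hsq i, mul_le_mul_of_nonneg_left hℓsq (sq_nonneg η)]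
  have hsum : ∑ i, (-(η * ℓ i) - Real.log (1 - η * ℓ i)) ≤ K * (η / 2) := by
    simpa using Finset.sum_le_sum fun i (_ : i ∈ Finset.univ) => hhalf i
  calc ∑ i, ebar i * (-(η * ℓ i) - Real.log (1 - η * ℓ i))
      = (1 - (S : ℝ) / T) * (-(η * ℓ j) - Real.log (1 - η * ℓ j))
        + S / (T * K) * ∑ i, (-(η * ℓ i) - Real.log (1 - η * ℓ i)) := by
        simp only [hebar, he, add_mul, Finset.sum_add_distrib, ← Finset.mul_sum, mul_assoc,
          ite_mul, one_mul, zero_mul, Finset.sum_ite_eq', Finset.mem_univ, if_true]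
    _ ≤ 1 * (η ^ 2 * ℓ j ^ 2) + S / (T * K) * (K * (η / 2)) := by
        gcongr ?_ + _ * ?_
        · exact (mul_le_mul_of_nonneg_left (hsq j) (by linarith)).trans
            (mul_le_mul_of_nonneg_right (by linarith) (by positivity))
    _ = η ^ 2 * (ℓ j) ^ 2 + η * S / (2 * T) := by
        field_simp
end
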